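/- Let θ ≥ 2 be an integer and let α = (α_1,…,α_r) and β = (β_1,…,β_m) be tuples of positive integers with α_i ≥ 2 for all 1 ≤ i ≤ r and β_m ≥ 2 (when m ≥ 1). Then Σ_{k=0}^{r} (-1)^{r-k} · ζ⋆(α_1,…,α_k) · Z_L((θ, α_r, α_{r-1},…,α_{k+1}); β) = ζ⋆(α_1,…,α_r, θ, β_1,…,β_m). -/

import Mathlib

open scoped BigOperators

/-- Multiple zeta value `ζ(α₁,…,α_r) = Σ_{1 ≤ k₁ < ⋯ < k_r} k₁^{-α₁} ⋯ k_r^{-α_r}`;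
`mzv [] = 1`. -/
noncomputable def mzv (α : List ℕ) : ℝ :=
  ∑' f : {f : Fin α.length → ℕ+ // StrictMono f},
    ∏ i : Fin α.length, ((f.1 i : ℝ) ^ (α.get i))⁻¹

/-- Multiple zeta-star value `ζ⋆(α₁,…,α_r) = Σ_{1 ≤ k₁ ≤ ⋯ ≤ k_r} k₁^{-α₁} ⋯ k_r^{-α_r}`;
`mzvStar [] = 1`. -/
noncomputable def mzvStar (α : List ℕ) : ℝ :=
  ∑' f : {f : Fin α.length → ℕ+ // Monotone f},
    ∏ i : Fin α.length, ((f.1 i : ℝ) ^ (α.get i))⁻¹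

/-- `Z_U(α;β) = Σ_{1≤k₁<⋯<k_r} k₁^{-α₁}⋯k_r^{-α_r} Σ_{1≤ℓ₁≤⋯≤ℓ_m≤k_r} ℓ₁^{-β₁}⋯ℓ_m^{-β_m}`. -/
noncomputable def ZU (α β : List ℕ) : ℝ :=
  ∑' p : {p : (Fin α.length → ℕ+) × (Fin β.length → ℕ+) //
      StrictMono p.1 ∧ Monotone p.2 ∧
      ∀ j : Fin β.length, (j : ℕ) = β.length - 1 →
        ∀ i : Fin α.length, (i : ℕ) = α.length - 1 → p.2 j ≤ p.1 i},
    (∏ i : Fin α.length, ((p.1.1 i : ℝ) ^ (α.get i))⁻¹) *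
      ∏ j : Fin β.length, ((p.1.2 j : ℝ) ^ (β.get j))⁻¹

/-- `Z_L(α;β) = Σ_{1≤k₁<⋯<k_r} k₁^{-α₁}⋯k_r^{-α_r} Σ_{k₁≤ℓ₁≤⋯≤ℓ_m} ℓ₁^{-β₁}⋯ℓ_m^{-β_m}`. -/
noncomputable def ZL (α β : List ℕ) : ℝ :=
  ∑' p : {p : (Fin α.length → ℕ+) × (Fin β.length → ℕ+) //
      StrictMono p.1 ∧ Monotone p.2 ∧
      ∀ i : Fin α.length, (i : ℕ) = 0 →
        ∀ j : Fin β.length, (j : ℕ) = 0 → p.1 i ≤ p.2 j},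
    (∏ i : Fin α.length, ((p.1.1 i : ℝ) ^ (α.get i))⁻¹) *
      ∏ j : Fin β.length, ((p.1.2 j : ℝ) ^ (β.get j))⁻¹

/-- `Z_B(α;β) = Σ_{1≤k₁<⋯<k_r} k₁^{-α₁}⋯k_r^{-α_r} Σ_{k₁≤ℓ₁≤⋯≤ℓ_m≤k_r} ℓ₁^{-β₁}⋯ℓ_m^{-β_m}`. -/
noncomputable def ZB (α β : List ℕ) : ℝ :=
  ∑' p : {p : (Fin α.length → ℕ+) × (Fin β.length → ℕ+) //
      StrictMono p.1 ∧ Monotone p.2 ∧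
      (∀ i : Fin α.length, (i : ℕ) = 0 →
        ∀ j : Fin β.length, (j : ℕ) = 0 → p.1 i ≤ p.2 j) ∧
      ∀ j : Fin β.length, (j : ℕ) = β.length - 1 →
        ∀ i : Fin α.length, (i : ℕ) = α.length - 1 → p.2 j ≤ p.1 i},
    (∏ i : Fin α.length, ((p.1.1 i : ℝ) ^ (α.get i))⁻¹) *
      ∏ j : Fin β.length, ((p.1.2 j : ℝ) ^ (β.get j))⁻¹

/-- The summand `∏ i, f i ^ (-α i)` attached to a list of exponents. -/
noncomputable def zetaWeight (α : List ℕ) (f : Fin α.length → ℕ+) : ℝ :=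
  ∏ i : Fin α.length, ((f i : ℝ) ^ (α.get i))⁻¹

theorem zetaWeight_nonneg (α : List ℕ) (f : Fin α.length → ℕ+) : 0 ≤ zetaWeight α f :=
  Finset.prod_nonneg fun _ _ => by positivity

theorem summable_pi_prod {n : ℕ} (g : Fin n → ℕ+ → ℝ) (hg0 : ∀ i x, 0 ≤ g i x)
    (hg : ∀ i, Summable (g i)) : Summable fun f : Fin n → ℕ+ => ∏ i, g i (f i) := by
  induction n with
  | zero => exact Summable.of_finite
  | succ n ih =>
    have htail := ih (fun i => g i.succ) (fun i => hg0 i.succ) fun i => hg i.succ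
    have htail0 : 0 ≤ fun f : Fin n → ℕ+ => ∏ i, g i.succ (f i) :=
      fun f => Finset.prod_nonneg fun i _ => hg0 i.succ (f i)
    have h := (hg 0).mul_of_nonneg htail (hg0 0) htail0
    rw [← (Fin.consEquiv (fun _ : Fin (n + 1) => ℕ+)).summable_iff]
    refine h.congr fun p => ?_
    simp [Fin.prod_univ_succ, Fin.consEquiv]

theorem summable_pnat_rpow_inv {s : ℝ} (hs : 1 < s) :
    Summable fun x : ℕ+ => ((x : ℝ) ^ s)⁻¹ :=
  (Real.summable_nat_rpow_inv.2 hs).comp_injective (i := fun x : ℕ+ => (x : ℕ))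
    PNat.coe_injective

theorem summable_zetaWeight {α : List ℕ} (hα : ∀ x ∈ α, 2 ≤ x) : Summable (zetaWeight α) := by
  refine summable_pi_prod (fun i x => ((x : ℝ) ^ (α.get i))⁻¹) (fun _ _ => by positivity) ?_
  intro i
  have h : (1 : ℝ) < (α.get i : ℝ) := by
    have := hα _ (α.get_mem i)
    exact_mod_cast this
  simpa using summable_pnat_rpow_inv h

theorem summable_indicator_monotone {β : List ℕ} (hβpos : ∀ x ∈ β, 0 < x)
    (hβ : ∀ h : β ≠ [], 2 ≤ β.getLast h) :
    Summable ({f : Fin β.length → ℕ+ | Monotone f}.indicator (zetaWeight β)) := by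
  rcases eq_or_ne β [] with rfl | hne
  · have : Finite (Fin ([] : List ℕ).length → ℕ+) := inferInstanceAs (Finite (Fin 0 → ℕ+))
    exact Summable.of_finite
  have hlen : 0 < β.length := List.length_pos_iff.2 hne
  have hlen' : (0 : ℝ) < β.length := by exact_mod_cast hlen
  set c : ℝ := (β.length : ℝ)⁻¹ with hc
  have hc0 : 0 < c := inv_pos.2 hlen'
  let z : Fin β.length := ⟨β.length - 1, by omega⟩
  have hz : 2 ≤ β.get z := by
    have := hβ hne
    rwa [List.getLast_eq_getElem] at this
  refine Summable.of_nonneg_of_le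
    (fun f => Set.indicator_nonneg (fun f _ => zetaWeight_nonneg β f) f) (fun f => ?_)
    (summable_pi_prod (fun (_ : Fin β.length) (x : ℕ+) => ((x : ℝ) ^ (1 + c))⁻¹)
      (fun _ _ => by positivity) fun _ => summable_pnat_rpow_inv (by linarith))
  refine Set.indicator_le' (s := {f : Fin β.length → ℕ+ | Monotone f})
    (f := zetaWeight β) (g := fun f => ∏ i, ((f i : ℝ) ^ (1 + c))⁻¹)
    (fun f hf => ?_) (fun f _ => Finset.prod_nonneg fun _ _ => by positivity) f
  have hf : Monotone f := hf
  have h1 : ∀ i, (1 : ℝ) ≤ f i := fun i => by exact_mod_cast (one_le : 1 ≤ f i)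
  simp only [zetaWeight, Finset.prod_inv_distrib]
  refine inv_anti₀ (Finset.prod_pos fun i _ => by positivity) ?_
  calc ∏ i, (f i : ℝ) ^ (1 + c) = (∏ i, (f i : ℝ)) * ∏ i, (f i : ℝ) ^ c := by
        rw [← Finset.prod_mul_distrib]
        refine Finset.prod_congr rfl fun i _ => ?_
        rw [Real.rpow_add (by positivity), Real.rpow_one]
    _ ≤ (∏ i, (f i : ℝ)) * ∏ _i : Fin β.length, (f z : ℝ) ^ c := by
        gcongr with i
        have : f i ≤ f z := hf (Fin.le_def.2 (by simp only [z]; omega))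
        exact_mod_cast this
    _ = (∏ i, (f i : ℝ)) * (f z : ℝ) := by
        rw [Finset.prod_const, Finset.card_univ, Fintype.card_fin, ← Real.rpow_natCast,
          ← Real.rpow_mul (by positivity), hc, inv_mul_cancel₀ hlen'.ne', Real.rpow_one]
    _ = ∏ i, (f i : ℝ) * (if i = z then (f i : ℝ) else 1) := by
        rw [Finset.prod_mul_distrib]
        simp
    _ ≤ ∏ i, (f i : ℝ) ^ (β.get i) := by
        refine Finset.prod_le_prod (fun i _ => by split_ifs <;> positivity) fun i _ => ?_
        split_ifs with h
        · subst h
          rw [← sq]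
          exact pow_le_pow_right₀ (h1 _) hz
        · rw [mul_one]
          exact le_self_pow₀ (h1 i) (hβpos _ (β.get_mem i)).ne'

theorem mzvStar_eq_tsum_indicator (α : List ℕ) :
    mzvStar α = ∑' f, {f : Fin α.length → ℕ+ | Monotone f}.indicator (zetaWeight α) f :=
  tsum_subtype {f : Fin α.length → ℕ+ | Monotone f} (zetaWeight α)

/-- The index set of `ZL α β`. -/
def lowerSet (α β : List ℕ) : Set ((Fin α.length → ℕ+) × (Fin β.length → ℕ+)) :=
  {p | StrictMono p.1 ∧ Monotone p.2 ∧
      ∀ i : Fin α.length, (i : ℕ) = 0 →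
        ∀ j : Fin β.length, (j : ℕ) = 0 → p.1 i ≤ p.2 j}

theorem ZL_eq_tsum_indicator (α β : List ℕ) :
    ZL α β = ∑' p, (lowerSet α β).indicator (fun p => zetaWeight α p.1 * zetaWeight β p.2) p :=
  tsum_subtype (lowerSet α β) fun p => zetaWeight α p.1 * zetaWeight β p.2

theorem summable_indicator_of_monotone_snd {α β : List ℕ} (hα : ∀ x ∈ α, 2 ≤ x)
    (hβpos : ∀ x ∈ β, 0 < x) (hβ : ∀ h : β ≠ [], 2 ≤ β.getLast h)
    {s : Set ((Fin α.length → ℕ+) × (Fin β.length → ℕ+))} (hs : ∀ p ∈ s, Monotone p.2) :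
    Summable (s.indicator fun p => zetaWeight α p.1 * zetaWeight β p.2) := by
  have hnn : ∀ p : (Fin α.length → ℕ+) × (Fin β.length → ℕ+),
      0 ≤ zetaWeight α p.1 * zetaWeight β p.2 := fun p =>
    mul_nonneg (zetaWeight_nonneg _ _) (zetaWeight_nonneg _ _)
  refine Summable.of_nonneg_of_le (fun p => Set.indicator_nonneg (fun p _ => hnn p) p)
    (fun p => ?_) ((summable_zetaWeight hα).mul_of_nonneg (summable_indicator_monotone hβpos hβ)
      (zetaWeight_nonneg α) (Set.indicator_nonneg fun f _ => zetaWeight_nonneg β f))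
  by_cases hp : p ∈ s
  · rw [Set.indicator_of_mem hp, Set.indicator_of_mem (show p.2 ∈ {f | Monotone f} from hs p hp)]
  · rw [Set.indicator_of_notMem hp]
    exact mul_nonneg (zetaWeight_nonneg _ _)
      (Set.indicator_nonneg (fun f _ => zetaWeight_nonneg β f) _)

theorem zetaWeight_split {L U V : List ℕ}
    (e : Fin U.length ⊕ Fin V.length ≃ Fin L.length)
    (hU : ∀ i, L.get (e (.inl i)) = U.get i) (hV : ∀ j, L.get (e (.inr j)) = V.get j)
    (x : Fin L.length → ℕ+) :
    zetaWeight L x =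
      zetaWeight U (fun i => x (e (.inl i))) * zetaWeight V (fun j => x (e (.inr j))) := by
  simp only [zetaWeight]
  rw [← e.prod_comp, Fintype.prod_sum_type]
  simp only [hU, hV]

theorem tsum_split {L U V : List ℕ} (e : Fin U.length ⊕ Fin V.length ≃ Fin L.length)
    (hU : ∀ i, L.get (e (.inl i)) = U.get i) (hV : ∀ j, L.get (e (.inr j)) = V.get j)
    (s : Set ((Fin U.length → ℕ+) × (Fin V.length → ℕ+))) :
    ∑' p, s.indicator (fun p => zetaWeight U p.1 * zetaWeight V p.2) p =
      ∑' x, {x : Fin L.length → ℕ+ |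
        ((fun i => x (e (.inl i)), fun j => x (e (.inr j))) : _ × _) ∈ s}.indicator
          (zetaWeight L) x := by
  classical
  let E := (e.arrowCongr (Equiv.refl ℕ+)).symm.trans (Equiv.sumArrowEquivProdArrow _ _ _)
  rw [← E.tsum_eq]
  refine tsum_congr fun x => ?_
  have hE : E x = (fun i => x (e (.inl i)), fun j => x (e (.inr j))) := rfl
  simp only [hE, Set.indicator_apply, Set.mem_ofPred_eq, zetaWeight_split e hU hV]

theorem mzvStar_mul_ZL {L U V β : List ℕ} (hUmem : ∀ x ∈ U, 2 ≤ x) (hVmem : ∀ x ∈ V, 2 ≤ x)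
    (hβpos : ∀ x ∈ β, 0 < x) (hβ : ∀ h : β ≠ [], 2 ≤ β.getLast h)
    (e : Fin U.length ⊕ Fin V.length ≃ Fin L.length)
    (hU : ∀ i, L.get (e (.inl i)) = U.get i) (hV : ∀ j, L.get (e (.inr j)) = V.get j) :
    mzvStar U * ZL V β = ∑' p : (Fin L.length → ℕ+) × (Fin β.length → ℕ+),
      {p : (Fin L.length → ℕ+) × (Fin β.length → ℕ+) | Monotone (fun i => p.1 (e (.inl i))) ∧
        ((fun j => p.1 (e (.inr j)), p.2) : _ × _) ∈ lowerSet V β}.indicator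
          (fun p => zetaWeight L p.1 * zetaWeight β p.2) p := by
  classical
  let E := (((e.arrowCongr (Equiv.refl ℕ+)).symm.trans
    (Equiv.sumArrowEquivProdArrow _ _ _)).prodCongr (Equiv.refl (Fin β.length → ℕ+))).trans
      (Equiv.prodAssoc _ _ _)
  rw [mzvStar_eq_tsum_indicator, ZL_eq_tsum_indicator, tsum_mul_tsum_of_summable_norm
    ((summable_zetaWeight hUmem).indicator _).norm
    (summable_indicator_of_monotone_snd hVmem hβpos hβ fun p hp => hp.2.1).norm, ← E.tsum_eq]
  refine tsum_congr fun p => ?_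
  have hE : E p = (fun i => p.1 (e (.inl i)), fun j => p.1 (e (.inr j)), p.2) := rfl
  simp only [hE, Set.indicator_apply, Set.mem_ofPred_eq, zetaWeight_split e hU hV, ite_and]
  split_ifs <;> ring

/-- The first `k` terms of `y 0, …, y r` increase weakly, the remaining ones decrease strictly. -/
def IsValleyAt {γ : Type*} [LinearOrder γ] (y : ℕ → γ) (r k : ℕ) : Prop :=
  (∀ i j, i ≤ j → j < k → y i ≤ y j) ∧ ∀ i j, k ≤ i → i < j → j ≤ r → y j < y i

open Classical in
theorem sum_neg_one_pow_isValleyAt {γ : Type*} [LinearOrder γ] (y : ℕ → γ) (r : ℕ) :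
    ∑ k ∈ Finset.range (r + 1), (-1 : ℝ) ^ (r - k) * (if IsValleyAt y r k then 1 else 0) =
      if ∀ i j, i ≤ j → j ≤ r → y i ≤ y j then 1 else 0 := by
  induction r with
  | zero =>
    have h1 : IsValleyAt y 0 0 := ⟨by omega, by omega⟩
    have h2 : ∀ i j, i ≤ j → j ≤ 0 → y i ≤ y j := by
      intro i j hij hj
      obtain rfl : i = j := by omega
      exact le_rfl
    rw [Finset.sum_range_one, if_pos h1, if_pos h2, pow_zero, mul_one]
  | succ r ih =>
    have hlast : IsValleyAt y (r + 1) (r + 1) ↔ ∀ i j, i ≤ j → j ≤ r → y i ≤ y j :=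
      ⟨fun h i j hij hj => h.1 i j hij (by omega),
        fun h => ⟨fun i j hij hj => h i j hij (by omega), fun i j h1 h2 h3 => by omega⟩⟩
    have hstep : ∀ k ≤ r, (IsValleyAt y (r + 1) k ↔ IsValleyAt y r k ∧ y (r + 1) < y r) := by
      intro k hk
      refine ⟨fun h => ⟨⟨h.1, fun i j h1 h2 h3 => h.2 i j h1 h2 (by omega)⟩,
        h.2 _ _ hk (by omega) le_rfl⟩, fun h => ⟨h.1.1, fun i j h1 h2 h3 => ?_⟩⟩
      rcases Nat.lt_or_ge r j with hj | hj
      · obtain rfl : j = r + 1 := by omega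
        rcases Nat.lt_or_ge i r with hi | hi
        · exact h.2.trans (h.1.2 i r h1 hi le_rfl)
        · obtain rfl : i = r := by omega
          exact h.2
      · exact h.1.2 i j h1 h2 hj
    have hmono : (∀ i j, i ≤ j → j ≤ r + 1 → y i ≤ y j) ↔
        (∀ i j, i ≤ j → j ≤ r → y i ≤ y j) ∧ ¬ y (r + 1) < y r := by
      refine ⟨fun h => ⟨fun i j h1 h2 => h i j h1 (by omega),
        not_lt.2 (h _ _ (by omega) le_rfl)⟩, fun h i j h1 h2 => ?_⟩
      rcases Nat.lt_or_ge r j with hj | hj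
      · obtain rfl : j = r + 1 := by omega
        rcases Nat.lt_or_ge r i with hi | hi
        · obtain rfl : i = r + 1 := by omega
          exact le_rfl
        · exact (h.1 i r hi le_rfl).trans (not_lt.1 h.2)
      · exact h.1 i j h1 hj
    have hsum : ∑ k ∈ Finset.range (r + 1),
        (-1 : ℝ) ^ (r + 1 - k) * (if IsValleyAt y (r + 1) k then 1 else 0) =
          -(if y (r + 1) < y r then 1 else 0) * ∑ k ∈ Finset.range (r + 1),
            (-1 : ℝ) ^ (r - k) * (if IsValleyAt y r k then 1 else 0) := by
      rw [Finset.mul_sum]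
      refine Finset.sum_congr rfl fun k hk => ?_
      have hk : k ≤ r := by simpa [Nat.lt_succ_iff] using hk
      rw [Nat.succ_sub hk, pow_succ]
      simp only [hstep k hk, ite_and]
      split_ifs <;> ring
    rw [Finset.sum_range_succ, hsum, ih]
    simp only [hlast, hmono, ite_and, Nat.sub_self, pow_zero]
    split_ifs <;> norm_num

/-- The index bijection behind the splitting of a list into its first `k` entries and the
reversal of the others. -/
theorem exists_takeDropReverseEquiv (L : List ℕ) {k : ℕ} (hk : k ≤ L.length) :
    ∃ e : Fin (L.take k).length ⊕ Fin (L.drop k).reverse.length ≃ Fin L.length,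
      (∀ i, (e (.inl i) : ℕ) = i) ∧ ∀ j, (e (.inr j) : ℕ) = L.length - 1 - j := by
  have h1 : (L.take k).length = k := by simp [hk]
  have h2 : (L.drop k).reverse.length = L.length - k := by simp
  let g : Fin (L.take k).length ⊕ Fin (L.drop k).reverse.length → Fin L.length :=
    Sum.elim (fun i => ⟨i, by omega⟩) fun j => ⟨L.length - 1 - j, by omega⟩
  have hg : Function.Bijective g := by
    rw [Fintype.bijective_iff_injective_and_card]
    constructor
    · rintro (i | i) (j | j) h <;> simp only [g, Sum.elim_inl, Sum.elim_inr, Fin.mk.injEq] at h <;>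
        first | (congr 1; ext; omega) | omega
    · simp only [Fintype.card_sum, Fintype.card_fin]
      omega
  exact ⟨Equiv.ofBijective g hg, fun _ => rfl, fun _ => rfl⟩

/-- Extension of a finite tuple to a sequence. -/
def extendTuple {n : ℕ} (x : Fin n → ℕ+) (i : ℕ) : ℕ+ :=
  if h : i < n then x ⟨i, h⟩ else 1

theorem extendTuple_val {n : ℕ} (x : Fin n → ℕ+) (i : Fin n) : extendTuple x i = x i := by
  simp [extendTuple]

theorem mzvStar_take_mul_ZL {L β : List ℕ} {r k : ℕ} (hr : L.length = r + 1) (hk : k ≤ r)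
    (hL : ∀ x ∈ L, 2 ≤ x) (hβpos : ∀ x ∈ β, 0 < x) (hβ : ∀ h : β ≠ [], 2 ≤ β.getLast h) :
    mzvStar (L.take k) * ZL (L.drop k).reverse β =
      ∑' p : (Fin L.length → ℕ+) × (Fin β.length → ℕ+),
      {p : (Fin L.length → ℕ+) × (Fin β.length → ℕ+) | IsValleyAt (extendTuple p.1) r k ∧
        Monotone p.2 ∧ ∀ j : Fin β.length, (j : ℕ) = 0 → extendTuple p.1 r ≤ p.2 j}.indicator
          (fun p => zetaWeight L p.1 * zetaWeight β p.2) p := by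
  obtain ⟨e, he1, he2⟩ := exists_takeDropReverseEquiv L (k := k) (by omega)
  have h1 : (L.take k).length = k := by simp; omega
  have h2 : (L.drop k).reverse.length = r + 1 - k := by simp [hr]
  rw [mzvStar_mul_ZL (fun x hx => hL x (List.mem_of_mem_take hx))
    (fun x hx => hL x (List.mem_of_mem_drop (List.mem_reverse.1 hx))) hβpos hβ e
    (fun i => by simp [he1]) (fun j => by
      have := j.2
      simp only [List.get_eq_getElem, he2, List.getElem_reverse, List.getElem_drop,
        List.length_drop]
      congr 1
      omega)]
  congr 1
  ext p
  congr 1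
  ext p
  have hl : ∀ i, p.1 (e (.inl i)) = extendTuple p.1 i := fun i => by
    rw [← extendTuple_val p.1, he1]
  have hr' : ∀ j, p.1 (e (.inr j)) = extendTuple p.1 (r - j) := fun j => by
    rw [← extendTuple_val p.1, he2, show L.length - 1 = r by omega]
  simp only [lowerSet, Set.mem_ofPred_eq, hl, hr', IsValleyAt]
  generalize extendTuple p.1 = y
  constructor
  · rintro ⟨hm, hs, hb, hc⟩
    refine ⟨⟨fun i j hij hj => ?_, fun i j hi hij hj => ?_⟩, hb, fun j hj => ?_⟩
    · exact @hm ⟨i, by omega⟩ ⟨j, by omega⟩ hij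
    · have := @hs ⟨r - j, by omega⟩ ⟨r - i, by omega⟩ (Fin.lt_def.2 (by simp only; omega))
      simpa only [Nat.sub_sub_self hj, Nat.sub_sub_self (hij.le.trans hj)] using this
    · exact hc ⟨0, by omega⟩ rfl j hj
  · rintro ⟨⟨hm, hs⟩, hb, hc⟩
    refine ⟨fun i j hij => hm _ _ hij (by omega), fun i j hij => ?_, hb, fun i hi j hj => ?_⟩
    · have hij := Fin.lt_def.1 hij
      exact hs _ _ (by omega) (by omega) (by omega)
    · rw [hi]
      exact hc j hj

theorem mzvStar_append {L β : List ℕ} {r : ℕ} (hr : L.length = r + 1) :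
    mzvStar (L ++ β) = ∑' p : (Fin L.length → ℕ+) × (Fin β.length → ℕ+),
      {p : (Fin L.length → ℕ+) × (Fin β.length → ℕ+) |
        (∀ i j, i ≤ j → j ≤ r → extendTuple p.1 i ≤ extendTuple p.1 j) ∧
        Monotone p.2 ∧ ∀ j : Fin β.length, (j : ℕ) = 0 → extendTuple p.1 r ≤ p.2 j}.indicator
          (fun p => zetaWeight L p.1 * zetaWeight β p.2) p := by
  let e : Fin L.length ⊕ Fin β.length ≃ Fin (L ++ β).length :=
    finSumFinEquiv.trans (finCongr List.length_append.symm)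
  have he1 : ∀ i, (e (.inl i) : ℕ) = i := fun i => by simp [e]
  have he2 : ∀ j, (e (.inr j) : ℕ) = L.length + j := fun j => by simp [e]
  rw [mzvStar_eq_tsum_indicator, tsum_split e (fun i => by simp [he1]) (fun j => by simp [he2])]
  congr 1
  ext x
  congr 1
  ext x
  have hl : ∀ i : Fin L.length, extendTuple (fun i => x (e (.inl i))) i = x (e (.inl i)) :=
    fun i => extendTuple_val _ i
  have hl' : ∀ i (h : i < L.length), extendTuple (fun i => x (e (.inl i))) i =
    x (e (.inl ⟨i, h⟩)) := fun i h => hl ⟨i, h⟩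
  simp only [Set.mem_ofPred_eq]
  constructor
  · intro hm
    refine ⟨fun i j hij hj => ?_, fun i j hij => hm ?_, fun j hj => ?_⟩
    · rw [hl' i (by omega), hl' j (by omega)]
      refine hm (Fin.le_def.2 ?_)
      rwa [he1, he1]
    · rw [Fin.le_def, he2, he2]
      have := Fin.le_def.1 hij
      omega
    · rw [hl' r (by omega)]
      refine hm (Fin.le_def.2 ?_)
      rw [he1, he2]
      simp only
      omega
  · rintro ⟨hm, hb, hc⟩ a b hab
    obtain ⟨a, rfl⟩ := e.surjective a
    obtain ⟨b, rfl⟩ := e.surjective b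
    rw [Fin.le_def] at hab
    rcases a with i | i <;> rcases b with j | j <;> simp only [he1, he2] at hab
    · rw [← hl, ← hl]
      exact hm _ _ hab (by omega)
    · rw [← hl]
      have h0 : 0 < β.length := by omega
      exact ((hm i r (by omega) le_rfl).trans (hc ⟨0, h0⟩ rfl)).trans
        (hb (Fin.le_def.2 (Nat.zero_le _)))
    · omega
    · exact hb (Fin.le_def.2 (by omega))

/-- Proposition 3.1, Eq. (3.4). -/
theorem stmt_12 (θ : ℕ) (hθ : 2 ≤ θ) (α β : List ℕ)
    (hα : ∀ x ∈ α, 2 ≤ x) (hβpos : ∀ x ∈ β, 0 < x)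
    (hβ : ∀ h : β ≠ [], 2 ≤ β.getLast h) :
    ∑ k ∈ Finset.range (α.length + 1),
      (-1 : ℝ) ^ (α.length - k) * mzvStar (α.take k) *
        ZL (θ :: (α.drop k).reverse) β
    = mzvStar (α ++ θ :: β) := by
  classical
  have hr : (α ++ [θ]).length = α.length + 1 := by simp
  have hL : ∀ x ∈ α ++ [θ], 2 ≤ x := by
    simp only [List.mem_append, List.mem_singleton]
    rintro x (hx | rfl)
    exacts [hα x hx, hθ]
  have hterm : ∀ k ∈ Finset.range (α.length + 1),
      (-1 : ℝ) ^ (α.length - k) * mzvStar (α.take k) * ZL (θ :: (α.drop k).reverse) β =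
        (-1 : ℝ) ^ (α.length - k) *
          (mzvStar ((α ++ [θ]).take k) * ZL ((α ++ [θ]).drop k).reverse β) := by
    intro k hk
    have hk : k ≤ α.length := by simpa [Nat.lt_succ_iff] using hk
    rw [List.take_append_of_le_length hk, List.drop_append_of_le_length hk, List.reverse_append,
      List.reverse_singleton, List.singleton_append, mul_assoc]
  rw [Finset.sum_congr rfl hterm, show α ++ θ :: β = (α ++ [θ]) ++ β by simp, mzvStar_append hr]
  generalize α ++ [θ] = L at *
  rw [Finset.sum_congr rfl fun k hk => by
    rw [mzvStar_take_mul_ZL hr (Nat.lt_succ_iff.1 (Finset.mem_range.1 hk)) hL hβpos hβ,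
      ← tsum_mul_left]]
  rw [← Summable.tsum_finsetSum fun k _ =>
    (summable_indicator_of_monotone_snd hL hβpos hβ fun p hp => hp.2.1).mul_left _]
  refine tsum_congr fun p => ?_
  simp only [Set.indicator_apply, Set.mem_ofPred_eq, ite_and]
  have key := sum_neg_one_pow_isValleyAt (extendTuple p.1) α.length
  by_cases h1 : Monotone p.2
  · by_cases h2 : ∀ j : Fin β.length, (j : ℕ) = 0 → extendTuple p.1 α.length ≤ p.2 j
    · simp only [if_pos h1, if_pos h2]
      rw [← one_mul (zetaWeight L p.1 * zetaWeight β p.2), ← zero_mul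
        (zetaWeight L p.1 * zetaWeight β p.2), ← ite_mul, ← key, Finset.sum_mul]
      refine Finset.sum_congr rfl fun k _ => ?_
      split_ifs <;> ring
    · simp [if_neg h2]
  · simp [if_neg h1]
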